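/- arXiv:1401.3215 — 5 statements merged into one kernel-verified Lean document; each statement's English description precedes it below -/
import Mathlib

section
/- Let m ≥ 1, let α be a primitive element (a generator of the multiplicative group) of 𝔽_{2^m}, let t be a positive divisor of 2^m − 1, and set l = (2^m − 1)/t. Then the element S = Σ_{μ=1}^{l−1} (α^{μt} + 1)^{−1} of 𝔽_{2^m} satisfies S² = S, and hence S = 0 or S = 1. (Each α^{μt} + 1 is nonzero for 1 ≤ μ ≤ l − 1 since α^{μt} ≠ 1 for those μ.) -/
/-- Multiplication by `k` coprime to `l` permutes the nonzero residues modulo `l`. -/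
theorem sum_Icc_mul_mod_of_coprime {M : Type*} [AddCommMonoid M] (f : ℕ → M) {k l : ℕ}
    (hkl : l.Coprime k) :
    ∑ μ ∈ Finset.Icc 1 (l - 1), f (k * μ % l) = ∑ μ ∈ Finset.Icc 1 (l - 1), f μ := by
  have hmaps : Set.MapsTo (fun μ => k * μ % l) (Finset.Icc 1 (l - 1)) (Finset.Icc 1 (l - 1)) := by
    intro μ hμ
    simp only [Finset.coe_Icc, Set.mem_Icc] at hμ ⊢
    have hlt : k * μ % l < l := Nat.mod_lt _ (by omega)
    have hne : k * μ % l ≠ 0 := fun h =>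
      absurd (Nat.le_of_dvd hμ.1 (hkl.dvd_of_dvd_mul_left (Nat.dvd_of_mod_eq_zero h))) (by omega)
    omega
  have hinj : Set.InjOn (fun μ => k * μ % l) (Finset.Icc 1 (l - 1)) := by
    intro a ha b hb hab
    simp only [Finset.coe_Icc, Set.mem_Icc] at ha hb
    exact (Nat.ModEq.cancel_left_of_coprime hkl hab).eq_of_lt_of_lt (by omega) (by omega)
  exact Finset.sum_nbij _ hmaps hinj
    (Finset.surjOn_of_injOn_of_card_le _ hmaps hinj le_rfl) fun _ _ => rfl

/-- In characteristic two, `∑ (β ^ μ + 1)⁻¹` over the nonzero residues `μ` modulo an odd `l`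
with `β ^ l = 1` is fixed by the Frobenius. -/
theorem sq_sum_inv_pow_add_one {F : Type*} [Field F] [CharP F 2] {β : F} {l : ℕ} (hl : Odd l)
    (hβ : β ^ l = 1) :
    (∑ μ ∈ Finset.Icc 1 (l - 1), (β ^ μ + 1)⁻¹) ^ 2 =
      ∑ μ ∈ Finset.Icc 1 (l - 1), (β ^ μ + 1)⁻¹ := by
  rw [CharTwo.sum_sq, ← sum_Icc_mul_mod_of_coprime (fun μ => (β ^ μ + 1)⁻¹) hl.coprime_two_right]
  refine Finset.sum_congr rfl fun μ _ => ?_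
  rw [inv_pow, CharTwo.add_sq, one_pow, ← pow_mul, mul_comm μ, ← pow_eq_pow_mod _ hβ]

/-- Let `α` be a primitive element of `𝔽_{2^m}` (a generator of the multiplicative
group), `t ∣ 2^m - 1` with `t > 0`, and `l = (2^m - 1)/t`.  Then
`S = ∑_{μ=1}^{l-1} (α^{μt} + 1)⁻¹` satisfies `S² = S`, hence `S = 0` or `S = 1`. -/
theorem sum_inv_pow_add_one_idempotent
    (m : ℕ) (hm : 1 ≤ m)
    (F : Type) [Field F] [Fintype F] (hcard : Fintype.card F = 2 ^ m)
    (α : F) (hα : ∀ x : F, x ≠ 0 → ∃ k : ℕ, x = α ^ k)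
    (t l : ℕ) (ht : 0 < t) (htdvd : t ∣ 2 ^ m - 1) (hl : l = (2 ^ m - 1) / t) :
    (∑ μ ∈ Finset.Icc 1 (l - 1), (α ^ (μ * t) + 1)⁻¹) ^ 2 =
      ∑ μ ∈ Finset.Icc 1 (l - 1), (α ^ (μ * t) + 1)⁻¹ ∧
    ((∑ μ ∈ Finset.Icc 1 (l - 1), (α ^ (μ * t) + 1)⁻¹) = 0 ∨
      (∑ μ ∈ Finset.Icc 1 (l - 1), (α ^ (μ * t) + 1)⁻¹) = 1) := by
  have : CharP F 2 := charP_of_card_eq_prime_pow hcard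
  have hsq : (∑ μ ∈ Finset.Icc 1 (l - 1), (α ^ (μ * t) + 1)⁻¹) ^ 2 =
      ∑ μ ∈ Finset.Icc 1 (l - 1), (α ^ (μ * t) + 1)⁻¹ := by
    have htl : t * l = 2 ^ m - 1 := by rw [hl, Nat.mul_div_cancel' htdvd]
    rcases eq_or_ne α 0 with rfl | hα0
    · rw [CharTwo.sum_sq]
      refine Finset.sum_congr rfl fun μ hμ => ?_
      have hμt : μ * t ≠ 0 := mul_ne_zero (by grind) ht.ne'
      simp [zero_pow hμt]
    · have hodd : Odd l := by
        have h : Odd (t * l) := by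
          rw [htl]
          exact Nat.Even.sub_odd Nat.one_le_two_pow (even_two.pow_of_ne_zero (by omega)) odd_one
        exact (Nat.odd_mul.mp h).2
      have hpow : (α ^ t) ^ l = 1 := by
        rw [← pow_mul, htl, ← hcard]
        exact FiniteField.pow_card_sub_one_eq_one α hα0
      simpa only [← pow_mul, mul_comm t] using sq_sum_inv_pow_add_one hodd hpow
  exact ⟨hsq, eq_zero_or_one_of_sq_eq_self hsq⟩
end

section
/- Let m ≥ 1, let α be a primitive element of 𝔽_{2^m}, let t be a positive divisor of 2^m − 1 with t ≥ 1, and set l = (2^m − 1)/t. Let β ∈ 𝔽_{2^m} be nonzero with β^t ≠ 1, and set γ_i = α^{l·i}·β for i = 0, 1, …, t − 1 (these are t distinct elements, none of which is a t-th root of unity, so each z − γ_i is a unit modulo z^t + 1). Then in the quotient ring 𝔽_{2^m}[z]/(z^t + 1) one has Σ_{i=0}^{t−1} (z − γ_i)^{−1} = (β^t + 1)^{−1} · z^{t−1}. -/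
open Polynomial

/-- A power generator of the nonzero elements of a finite field is a primitive root of unity. -/
theorem isPrimitiveRoot_card_sub_one_of_forall_eq_pow {F : Type*} [Field F] [Fintype F] {α : F}
    (h0 : α ≠ 0) (hα : ∀ x : F, x ≠ 0 → ∃ k : ℕ, x = α ^ k) :
    IsPrimitiveRoot α (Fintype.card F - 1) := by
  have horder : orderOf (Units.mk0 α h0) = Nat.card Fˣ := by
    refine orderOf_eq_card_of_forall_mem_zpowers fun x => ?_
    obtain ⟨k, hk⟩ := hα x x.ne_zero
    exact ⟨k, by ext; simp [hk]⟩
  rw [Nat.card_units, Nat.card_eq_fintype_card] at horder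
  rw [← horder]
  exact IsPrimitiveRoot.coe_units_iff.2 (IsPrimitiveRoot.orderOf (Units.mk0 α h0))

/-- If the product of a finite family is a unit with inverse `b`, the sum of the inverses of the
factors is `b` times the sum of the complementary products. -/
theorem sum_ringInverse_eq_mul_sum_prod_erase {ι R : Type*} [DecidableEq ι] [CommRing R]
    (s : Finset ι) (f : ι → R) {b : R} (hb : b * ∏ i ∈ s, f i = 1) :
    ∑ i ∈ s, Ring.inverse (f i) = b * ∑ i ∈ s, ∏ j ∈ s.erase i, f j := by
  rw [Finset.mul_sum]
  refine Finset.sum_congr rfl fun i hi => ?_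
  have h : f i * (b * ∏ j ∈ s.erase i, f j) = 1 := by
    rw [← hb, ← Finset.mul_prod_erase s f hi]
    ring
  exact Ring.inverse_unit (Units.mkOfMulEqOne _ _ h)

/-- Let `α` be a primitive element of `𝔽_{2^m}`, `t ∣ 2^m - 1` a positive divisor,
`l = (2^m-1)/t`, and let `β ≠ 0` with `β^t ≠ 1`.  Put `γ_i = α^{l·i}·β` for
`0 ≤ i ≤ t-1`.  Then in `𝔽_{2^m}[z]/(z^t + 1)` one has
`∑_{i=0}^{t-1} (z - γ_i)⁻¹ = (β^t + 1)⁻¹ · z^{t-1}`. -/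
theorem sum_inv_linear_coset_eq
    (m : ℕ) (hm : 1 ≤ m)
    (F : Type) [Field F] [Fintype F] (hcard : Fintype.card F = 2 ^ m)
    (α : F) (hα : ∀ x : F, x ≠ 0 → ∃ k : ℕ, x = α ^ k)
    (t l : ℕ) (ht : 1 ≤ t) (htdvd : t ∣ 2 ^ m - 1) (hl : l = (2 ^ m - 1) / t)
    (β : F) (hβ : β ≠ 0) (hβt : β ^ t ≠ 1) :
    ∑ i ∈ Finset.range t,
        Ring.inverse (Ideal.Quotient.mk (Ideal.span {(X ^ t + 1 : F[X])})
          (X - C (α ^ (l * i) * β))) =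
      Ideal.Quotient.mk (Ideal.span {(X ^ t + 1 : F[X])})
        (C ((β ^ t + 1)⁻¹) * X ^ (t - 1)) := by
  have h2 : (2 : F) = 0 := by
    have h := FiniteField.cast_card_eq_zero F
    rw [hcard, Nat.cast_pow] at h
    exact_mod_cast eq_zero_of_pow_eq_zero h
  have hα0 : α ≠ 0 := by
    rintro rfl
    obtain ⟨k, hk⟩ := hα β hβ
    rcases eq_or_ne k 0 with rfl | hk0
    · exact hβt (by simp [hk])
    · exact hβ (by simp [hk, hk0])
  have hpos : 0 < 2 ^ m - 1 := by
    have := Nat.one_lt_two_pow (n := m) (by omega)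
    omega
  have hroot : IsPrimitiveRoot (α ^ l) t := by
    refine IsPrimitiveRoot.pow hpos
      (hcard ▸ isPrimitiveRoot_card_sub_one_of_forall_eq_pow hα0 hα) ?_
    rw [hl, Nat.div_mul_cancel htdvd]
  have hodd : Odd t := by
    refine Odd.of_dvd_nat ?_ htdvd
    exact Nat.Even.sub_odd Nat.one_le_two_pow ((Nat.even_pow' (by omega)).2 even_two) odd_one
  have htF : (t : F) = 1 := by
    obtain ⟨k, rfl⟩ := hodd
    push_cast
    rw [h2]
    ring
  have hprod : ∏ i ∈ Finset.range t, (X - C (α ^ (l * i) * β)) = X ^ t - C (β ^ t) := by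
    rw [X_pow_sub_C_eq_prod hroot ht rfl]
    simp only [pow_mul]
  have hderiv : ∑ i ∈ Finset.range t, ∏ j ∈ (Finset.range t).erase i,
      (X - C (α ^ (l * j) * β)) = X ^ (t - 1) := by
    have h := congrArg derivative hprod
    rw [derivative_prod_finset] at h
    simpa only [derivative_sub, derivative_X, mul_one, derivative_X_pow, derivative_C,
      htF, C_1, one_mul, sub_zero] using h
  have hunit : β ^ t + 1 ≠ 0 := fun h => hβt (by linear_combination h - h2)
  set q := Ideal.Quotient.mk (Ideal.span {(X ^ t + 1 : F[X])})
  have hq : q (X ^ t + 1) = 0 :=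
    Ideal.Quotient.eq_zero_iff_mem.2 (Ideal.mem_span_singleton_self _)
  have hinv : q (C ((β ^ t + 1)⁻¹)) *
      ∏ i ∈ Finset.range t, q (X - C (α ^ (l * i) * β)) = 1 := by
    have hsplit : X ^ t - C (β ^ t) = (X ^ t + 1) + C (β ^ t + 1) := by
      have hC : (2 : F[X]) = 0 := by
        rw [← C_ofNat, h2, C_0]
      rw [C_add, C_1]
      linear_combination (-1 - C (β ^ t)) * hC
    rw [← map_prod, hprod, hsplit, map_add, hq, zero_add, ← map_mul, ← C_mul,
      inv_mul_cancel₀ hunit, C_1, map_one]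
  rw [sum_ringInverse_eq_mul_sum_prod_erase _ _ hinv, map_mul, ← hderiv]
  simp only [map_sum, map_prod]
end

section
/- Let m ≥ 2, n = 2^m − 1, let α be a primitive element of 𝔽_{2^m}, and let 2 ≤ δ ≤ n − 1. Then the number of vectors y ∈ 𝔽_{2^m}^n with all coordinates nonzero satisfying Σ_{i=0}^{n−1} y_i·α^{i·s} = 0 for all 0 ≤ s ≤ δ − 2 (i.e., the number of Hamming-weight-n codewords of the Reed–Solomon code RS(n,δ)) is strictly greater than (2^m − 1)^{n − δ}. -/
/-- If every nonzero element of `F` is a power of `α` and `F` has more than two elements,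
then `α` is nonzero. -/
theorem ne_zero_of_forall_eq_pow {F : Type*} [Field F] [Fintype F] {α : F}
    (hα : ∀ x : F, x ≠ 0 → ∃ k : ℕ, x = α ^ k) (hF : 2 < Fintype.card F) : α ≠ 0 := by
  classical
  rintro rfl
  obtain ⟨x, hx⟩ : ∃ x : F, x ∉ ({0, 1} : Finset F) := by
    by_contra! h
    have h1 := Finset.card_le_card (fun x _ => h x : (Finset.univ : Finset F) ⊆ {0, 1})
    rw [Finset.card_univ] at h1
    have h2 := Finset.card_le_two (a := (0 : F)) (b := 1)
    omega
  simp only [Finset.mem_insert, Finset.mem_singleton, not_or] at hx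
  obtain ⟨k, hk⟩ := hα x hx.1
  rcases Nat.eq_zero_or_pos k with rfl | hpos
  · exact hx.2 (by simpa using hk)
  · exact hx.1 (by rw [hk, zero_pow (by omega)])

/-- If every nonzero element of `F` is a power of `α`, then `α ^ t ≠ 1` for
`0 < t < |F| - 1`. -/
theorem pow_ne_one_of_forall_eq_pow {F : Type*} [Field F] [Fintype F] {α : F}
    (hα : ∀ x : F, x ≠ 0 → ∃ k : ℕ, x = α ^ k) {t : ℕ} (ht0 : 0 < t)
    (ht : t < Fintype.card F - 1) : α ^ t ≠ 1 := by
  classical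
  intro h
  have hsub : (Finset.univ : Finset F) ⊆ insert 0 ((Finset.range t).image (α ^ ·)) := by
    intro x _
    by_cases hx : x = 0
    · simp [hx]
    obtain ⟨k, rfl⟩ := hα x hx
    refine Finset.mem_insert_of_mem (Finset.mem_image.2
      ⟨k % t, Finset.mem_range.2 (Nat.mod_lt _ ht0), ?_⟩)
    exact (pow_eq_pow_mod k h).symm
  have h1 := Finset.card_le_card hsub
  have h2 := Finset.card_insert_le (0 : F) ((Finset.range t).image (α ^ ·))
  have h3 : ((Finset.range t).image (α ^ ·)).card ≤ (Finset.range t).card :=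
    Finset.card_image_le
  rw [Finset.card_univ] at h1
  rw [Finset.card_range] at h3
  omega

/-- A linear code of length `n < |F|` containing a full-weight word has at least `|C| / |F|`
full-weight words. -/
theorem card_le_card_mul_ncard_full_weight {F : Type*} [Field F] [Fintype F] {n : ℕ}
    (hn : n < Fintype.card F) (C : Submodule F (Fin n → F)) {w : Fin n → F} (hwC : w ∈ C)
    (hw : ∀ i, w i ≠ 0) :
    Nat.card C ≤ {y : Fin n → F | (∀ i, y i ≠ 0) ∧ y ∈ C}.ncard * Fintype.card F := by
  classical
  rw [← Nat.card_coe_set_eq, ← Nat.card_eq_fintype_card, ← Nat.card_prod]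
  let f : {y : Fin n → F | (∀ i, y i ≠ 0) ∧ y ∈ C} × F → C := fun p =>
    ⟨p.1.1 + p.2 • w, C.add_mem p.1.2.2 (C.smul_mem _ hwC)⟩
  refine Nat.card_le_card_of_surjective f fun c => ?_
  obtain ⟨μ, hμ⟩ : ∃ μ : F, ∀ i, c.1 i / w i ≠ μ := by
    by_contra! h
    have := Fintype.card_le_of_surjective (fun i => c.1 i / w i) h
    rw [Fintype.card_fin] at this
    omega
  refine ⟨⟨⟨c.1 - μ • w, fun i h => hμ i ?_, C.sub_mem c.2 (C.smul_mem _ hwC)⟩, μ⟩, ?_⟩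
  · rw [div_eq_iff (hw i)]
    simpa [sub_eq_zero] using h
  · ext i
    simp [f]

/-- A code cut out by `r` linear equations has at least `|F| ^ (n - r)` words. -/
theorem pow_card_le_card_ker {F : Type*} [Field F] [Fintype F] {n r : ℕ}
    (L : (Fin n → F) →ₗ[F] (Fin r → F)) :
    Fintype.card F ^ (n - r) ≤ Nat.card (LinearMap.ker L) := by
  rw [Module.natCard_eq_pow_finrank (K := F), Nat.card_eq_fintype_card]
  refine Nat.pow_le_pow_right Fintype.card_pos ?_
  have h1 := L.finrank_range_add_finrank_ker
  have h2 := (LinearMap.range L).finrank_le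
  simp only [Module.finrank_fin_fun] at h1 h2
  omega

/-- Let `n = 2^m - 1`, `α` primitive in `𝔽_{2^m}`, and `2 ≤ δ ≤ n-1`.  The number of
full-weight codewords of the Reed–Solomon code `RS(n,δ)` — vectors `y` with all
coordinates nonzero satisfying `∑ i y_i α^{is} = 0` for `0 ≤ s ≤ δ-2` — is
strictly greater than `(2^m - 1)^{n-δ}`. -/
theorem rs_full_weight_codewords_gt
    (m : ℕ) (hm : 2 ≤ m) (n : ℕ) (hn : n = 2 ^ m - 1)
    (F : Type) [Field F] [Fintype F] (hcard : Fintype.card F = 2 ^ m)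
    (α : F) (hα : ∀ x : F, x ≠ 0 → ∃ k : ℕ, x = α ^ k)
    (δ : ℕ) (hδ2 : 2 ≤ δ) (hδn : δ ≤ n - 1) :
    (2 ^ m - 1) ^ (n - δ) <
      {y : Fin n → F |
        (∀ i, y i ≠ 0) ∧ (∀ s ≤ δ - 2, ∑ i, y i * α ^ ((i : ℕ) * s) = 0)}.ncard := by
  have h4 : 4 ≤ 2 ^ m := (Nat.pow_le_pow_right (by norm_num) hm : 2 ^ 2 ≤ 2 ^ m)
  have hα0 : α ≠ 0 := ne_zero_of_forall_eq_pow hα (by omega)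
  have hαn : α ^ n = 1 := by
    rw [hn, ← hcard]
    exact FiniteField.pow_card_sub_one_eq_one α hα0
  let L : (Fin n → F) →ₗ[F] (Fin (δ - 1) → F) :=
    LinearMap.pi fun s => ∑ i : Fin n, (α ^ ((i : ℕ) * (s : ℕ))) • LinearMap.proj i
  have hmem (y : Fin n → F) :
      y ∈ LinearMap.ker L ↔ ∀ s ≤ δ - 2, ∑ i, y i * α ^ ((i : ℕ) * s) = 0 := by
    have hL (s : Fin (δ - 1)) : L y s = ∑ i, y i * α ^ ((i : ℕ) * (s : ℕ)) := by
      simp [L, mul_comm]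
    rw [LinearMap.mem_ker, funext_iff]
    refine ⟨fun h s hs => ?_, fun h s => ?_⟩
    · exact (hL ⟨s, by omega⟩).symm.trans (h _)
    · exact (hL s).trans (h s (by omega))
  have hw : (fun i : Fin n => α ^ (i : ℕ)) ∈ LinearMap.ker L := by
    rw [hmem]
    intro s hs
    have hne : α ^ (s + 1) ≠ 1 := pow_ne_one_of_forall_eq_pow hα (by omega) (by omega)
    calc ∑ i : Fin n, α ^ (i : ℕ) * α ^ ((i : ℕ) * s)
        = ∑ i : Fin n, (α ^ (s + 1)) ^ (i : ℕ) :=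
          Finset.sum_congr rfl fun i _ => by ring
      _ = ∑ i ∈ Finset.range n, (α ^ (s + 1)) ^ i :=
          Fin.sum_univ_eq_sum_range (fun i => (α ^ (s + 1)) ^ i) n
      _ = 0 := by
          rw [geom_sum_eq hne, ← pow_mul, mul_comm, pow_mul, hαn, one_pow, sub_self, zero_div]
  have hcount := (pow_card_le_card_ker L).trans
    (card_le_card_mul_ncard_full_weight (by omega) (LinearMap.ker L) hw
      fun i => pow_ne_zero _ hα0)
  simp only [hmem] at hcount
  rw [hcard, show n - (δ - 1) = n - δ + 1 by omega, pow_succ] at hcount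
  exact (Nat.pow_lt_pow_left (by omega) (by omega)).trans_le
    (Nat.le_of_mul_le_mul_right hcount (by omega))
end

section
/- For every real δ_0 with 0 < δ_0 < 1/2 and every ε > 0, there exists M such that for all m ≥ M, with n = 2^m − 1, there exists a binary linear code C ⊆ 𝔽_2^n (arising as a Sub-Alternant code) with the following properties: the all-ones vector of length n belongs to C, every nonzero codeword of C has Hamming weight at least δ_0·n, and dim C ≥ n·(1 − H(δ_0) − ε), where H is the binary entropy function. In other words, there exist arbitrarily long Sub-Alternant codes containing the all-ones word whose rate meets the Gilbert–Varshamov bound. -/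
/-- The binary Sub-Alternant code with `r` parity-check rows determined by a
primitive element `α` and column multipliers `y`. -/
def subAlternantCode (F : Type*) [Field F] [Algebra (ZMod 2) F] (n r : ℕ)
    (α : F) (y : Fin n → F) : Set (Fin n → ZMod 2) :=
  {c | ∀ s < r, ∑ i, algebraMap (ZMod 2) F (c i) * (y i * α ^ ((i : ℕ) * s)) = 0}

/-- The binary entropy function `H(x) = -x log₂ x - (1-x) log₂ (1-x)`. -/
noncomputable def binaryEntropy (x : ℝ) : ℝ :=
  -x * Real.logb 2 x - (1 - x) * Real.logb 2 (1 - x)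

open Finset in
/-- A weighted power sum over at most `r` distinct points whose first `r` moments vanish has all
its weights equal to zero. -/
theorem eq_zero_of_forall_sum_mul_pow_eq_zero {F ι : Type*} [Field F] [DecidableEq ι]
    {a : ι → F} (ha : Function.Injective a) {r : ℕ} {S : Finset ι} (hS : #S ≤ r) {y : ι → F}
    (hy : ∀ s < r, ∑ i ∈ S, y i * a i ^ s = 0) {i : ι} (hi : i ∈ S) : y i = 0 := by
  set p : Polynomial F := ∏ j ∈ S.erase i, (Polynomial.X - Polynomial.C (a j)) with hp
  have hdeg : p.natDegree < r := by
    rw [hp, Polynomial.natDegree_prod_of_monic _ _ fun j _ => Polynomial.monic_X_sub_C (a j)]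
    have := card_pos.2 ⟨i, hi⟩
    simp [card_erase_of_mem hi]
    omega
  have hsum : ∑ j ∈ S, y j * p.eval (a j) = 0 := by
    simp_rw [Polynomial.eval_eq_sum_range' hdeg, mul_sum]
    rw [sum_comm]
    refine sum_eq_zero fun s hs => ?_
    have h := hy s (mem_range.1 hs)
    calc ∑ j ∈ S, y j * (p.coeff s * a j ^ s) = p.coeff s * ∑ j ∈ S, y j * a j ^ s := by
          rw [mul_sum]; exact sum_congr rfl fun j _ => by ring
      _ = 0 := by rw [h, mul_zero]
  rw [sum_eq_single_of_mem i hi] at hsum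
  · refine (mul_eq_zero.1 hsum).resolve_right ?_
    rw [hp, Polynomial.eval_prod]
    refine prod_ne_zero_iff.2 fun j hj => ?_
    simpa [sub_eq_zero] using fun h => (mem_erase.1 hj).1 (ha h).symm
  · intro j hj hji
    rw [hp, Polynomial.eval_prod, prod_eq_zero (mem_erase.2 ⟨hji, hj⟩) (by simp), mul_zero]

open Finset in
/-- A difference-closed family of vectors containing no nonzero vector supported on `T` embeds
into the vectors indexed by the complement of `T`. -/
theorem card_filter_le_pow_of_eq_zero {F ι : Type*} [Field F] [Fintype F] [DecidableEq F]
    [Fintype ι] [DecidableEq ι] (P : (ι → F) → Prop) [DecidablePred P]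
    (hsub : ∀ y z, P y → P z → P (y - z)) (T : Finset ι)
    (hT : ∀ y, P y → (∀ i ∉ T, y i = 0) → ∀ i ∈ T, y i = 0) :
    #{y | P y} ≤ Fintype.card F ^ (Fintype.card ι - #T) := by
  have hcard : #(univ : Finset ({i // i ∉ T} → F)) = Fintype.card F ^ (Fintype.card ι - #T) := by
    rw [card_univ, Fintype.card_fun]
    congr 1
    simp [Fintype.card_subtype_compl]
  rw [← hcard]
  refine card_le_card_of_injOn (fun y i => y i) (fun _ _ => mem_coe.2 (mem_univ _)) ?_
  intro y hy z hz hyz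
  have hout : ∀ i ∉ T, (y - z) i = 0 := fun i hi => by
    simpa [sub_eq_zero] using congrFun hyz ⟨i, hi⟩
  have hin := hT (y - z) (hsub y z (by simpa using hy) (by simpa using hz)) hout
  ext i
  by_cases hi : i ∈ T
  · exact sub_eq_zero.1 (hin i hi)
  · exact sub_eq_zero.1 (hout i hi)

/-- The linear map sending a vector to its first `r` moments at the points `a`. -/
def momentMap {F ι : Type*} [Field F] [Fintype ι] (a : ι → F) (r : ℕ) :
    (ι → F) →ₗ[F] (Fin r → F) where
  toFun y s := ∑ i, y i * a i ^ (s : ℕ)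
  map_add' y z := by ext s; simp [add_mul, Finset.sum_add_distrib]
  map_smul' c y := by ext s; simp [mul_assoc, Finset.mul_sum]

open Finset in
theorem pow_le_card_filter_moments_eq_zero {F ι : Type*} [Field F] [Fintype F] [DecidableEq F]
    [Fintype ι] [DecidableEq ι] (a : ι → F) (r : ℕ) :
    Fintype.card F ^ (Fintype.card ι - r) ≤
      #{y : ι → F | ∀ s < r, ∑ i, y i * a i ^ s = 0} := by
  have hrank := (momentMap a r).finrank_range_add_finrank_ker
  have hrange := (LinearMap.range (momentMap a r)).finrank_le
  simp only [Module.finrank_fintype_fun_eq_card, Fintype.card_fin] at hrank hrange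
  have hker : #{y : ι → F | ∀ s < r, ∑ i, y i * a i ^ s = 0} =
      Nat.card (LinearMap.ker (momentMap a r)) := by
    rw [← Fintype.card_subtype, ← Nat.card_eq_fintype_card]
    refine Nat.card_congr (Equiv.subtypeEquivRight fun y => ?_)
    simp [momentMap, funext_iff, Fin.forall_iff]
  rw [hker, Module.natCard_eq_pow_finrank (K := F), Nat.card_eq_fintype_card]
  exact Nat.pow_le_pow_right Fintype.card_pos (by omega)

open Finset in
/-- Over a field with `card ι + 1` elements, there are multipliers without zero coordinate whose
first `r` moments vanish, avoiding vanishing moments on every member of a small family of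
supports. -/
theorem exists_multiplier {F ι : Type*} [Field F] [Fintype F] [Fintype ι] [DecidableEq ι]
    (hF : Fintype.card F = Fintype.card ι + 1) {a : ι → F} (ha : Function.Injective a) {r : ℕ}
    (hr : 1 ≤ r) (hr' : 2 * r ≤ Fintype.card ι) (𝒜 : Finset (Finset ι))
    (h𝒜 : ∀ S ∈ 𝒜, S.Nonempty ∧ #S + r ≤ Fintype.card ι)
    (hcard : #𝒜 < Fintype.card F ^ (r - 1)) :
    ∃ y : ι → F, (∀ i, y i ≠ 0) ∧ (∀ s < r, ∑ i, y i * a i ^ s = 0) ∧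
      ∀ S ∈ 𝒜, ¬ ∀ s < r, ∑ i ∈ S, y i * a i ^ s = 0 := by
  classical
  set q := Fintype.card F
  set n := Fintype.card ι with hn
  have hq : 0 < q := Fintype.card_pos
  let K : Finset (ι → F) := {y | ∀ s < r, ∑ i, y i * a i ^ s = 0}
  let Z (i : ι) : Finset (ι → F) := {y | (∀ s < r, ∑ i, y i * a i ^ s = 0) ∧ y i = 0}
  let B (S : Finset ι) : Finset (ι → F) := {y | (∀ i, y i ≠ 0) ∧
    (∀ s < r, ∑ i, y i * a i ^ s = 0) ∧ ∀ s < r, ∑ i ∈ S, y i * a i ^ s = 0}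
  have hsub (S : Finset ι) (y z : ι → F) (hy : ∀ s < r, ∑ i ∈ S, y i * a i ^ s = 0)
      (hz : ∀ s < r, ∑ i ∈ S, z i * a i ^ s = 0) :
      ∀ s < r, ∑ i ∈ S, (y - z) i * a i ^ s = 0 := fun s hs => by
    simp [sub_mul, hy s hs, hz s hs]
  have hZ (i : ι) : #(Z i) ≤ q ^ (n - r - 1) := by
    obtain ⟨T, hTi, hT⟩ := exists_subset_card_eq (s := univ.erase i) (n := r)
      (by rw [card_erase_of_mem (mem_univ i), card_univ]; omega)
    have hiT : i ∉ T := fun h => by simpa using hTi h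
    have := card_filter_le_pow_of_eq_zero
      (fun y : ι → F => (∀ s < r, ∑ i, y i * a i ^ s = 0) ∧ y i = 0)
      (fun y z hy hz => ⟨hsub univ y z hy.1 hz.1, by simp [hy.2, hz.2]⟩) (insert i T) ?_
    · rwa [card_insert_of_notMem hiT, hT, ← hn, ← Nat.sub_sub] at this
    · intro y hy hout j hj
      rcases mem_insert.1 hj with rfl | hj
      · exact hy.2
      refine eq_zero_of_forall_sum_mul_pow_eq_zero ha hT.le (fun s hs => ?_) hj
      rw [← hy.1 s hs]
      refine sum_subset (subset_univ T) fun k _ hk => ?_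
      by_cases hki : k = i
      · rw [hki, hy.2, zero_mul]
      · rw [hout k (by simp [hki, hk]), zero_mul]
  have hB (S : Finset ι) (hS : S ∈ 𝒜) : #(B S) ≤ q ^ (n - 2 * r) := by
    obtain ⟨⟨i, hi⟩, hSr⟩ := h𝒜 S hS
    rcases le_or_gt (#S) r with hle | hlt
    · have : B S = ∅ := by
        refine eq_empty_of_forall_notMem fun y hy => ?_
        simp only [B, mem_filter, mem_univ, true_and] at hy
        exact hy.1 i (eq_zero_of_forall_sum_mul_pow_eq_zero ha hle hy.2.2 hi)
      simp [this]
    obtain ⟨T, hTS, hT⟩ := exists_subset_card_eq hlt.le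
    obtain ⟨U, hUS, hU⟩ := exists_subset_card_eq (s := Sᶜ) (n := r) (by rw [card_compl]; omega)
    have hdis : Disjoint T U := disjoint_of_subset_left hTS
      (disjoint_of_subset_right hUS disjoint_compl_right)
    refine (card_le_card (t := ({y | (∀ s < r, ∑ i ∈ S, y i * a i ^ s = 0) ∧
      ∀ s < r, ∑ i ∈ Sᶜ, y i * a i ^ s = 0} : Finset (ι → F))) fun y hy => ?_).trans ?_
    · simp only [B, mem_filter, mem_univ, true_and] at hy ⊢
      refine ⟨hy.2.2, fun s hs => ?_⟩
      have := sum_add_sum_compl S fun i => y i * a i ^ s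
      rwa [hy.2.1 s hs, hy.2.2 s hs, zero_add] at this
    have := card_filter_le_pow_of_eq_zero
      (fun y : ι → F => (∀ s < r, ∑ i ∈ S, y i * a i ^ s = 0) ∧
        ∀ s < r, ∑ i ∈ Sᶜ, y i * a i ^ s = 0)
      (fun y z hy hz => ⟨hsub S y z hy.1 hz.1, hsub Sᶜ y z hy.2 hz.2⟩) (T ∪ U) ?_
    · rwa [card_union_of_disjoint hdis, hT, hU, ← hn, ← two_mul] at this
    · intro y hy hout j hj
      rcases mem_union.1 hj with hj | hj
      · refine eq_zero_of_forall_sum_mul_pow_eq_zero ha hT.le (fun s hs => ?_) hj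
        rw [← hy.1 s hs]
        refine sum_subset hTS fun k hkS hkT => ?_
        have hkU : k ∉ U := fun h => mem_compl.1 (hUS h) hkS
        rw [hout k (by simp [hkT, hkU]), zero_mul]
      · refine eq_zero_of_forall_sum_mul_pow_eq_zero ha hU.le (fun s hs => ?_) hj
        rw [← hy.2 s hs]
        refine sum_subset hUS fun k hkS hkU => ?_
        have hkT : k ∉ T := fun h => mem_compl.1 hkS (hTS h)
        rw [hout k (by simp [hkT, hkU]), zero_mul]
  by_contra! hcon
  have hcover : K ⊆ univ.biUnion Z ∪ 𝒜.biUnion B := by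
    intro y hy
    simp only [K, mem_filter, mem_univ, true_and] at hy
    by_cases h0 : ∀ i, y i ≠ 0
    · obtain ⟨S, hS, hSy⟩ := hcon y h0 hy
      exact mem_union_right _ (mem_biUnion.2 ⟨S, hS, mem_filter.2 ⟨mem_univ y, h0, hy, hSy⟩⟩)
    · push Not at h0
      obtain ⟨i, hi⟩ := h0
      exact mem_union_left _ (mem_biUnion.2 ⟨i, mem_univ i, mem_filter.2 ⟨mem_univ y, hy, hi⟩⟩)
  have hle : q ^ (n - r) ≤ n * q ^ (n - r - 1) + #𝒜 * q ^ (n - 2 * r) :=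
    calc q ^ (n - r) ≤ #K := pow_le_card_filter_moments_eq_zero a r
      _ ≤ #(univ.biUnion Z) + #(𝒜.biUnion B) := (card_le_card hcover).trans (card_union_le _ _)
      _ ≤ n * q ^ (n - r - 1) + #𝒜 * q ^ (n - 2 * r) :=
        add_le_add (card_biUnion_le_card_mul _ _ _ fun i _ => hZ i)
          (card_biUnion_le_card_mul _ _ _ hB)
  have hlt : #𝒜 * q ^ (n - 2 * r) < q ^ (n - r - 1) :=
    calc #𝒜 * q ^ (n - 2 * r) < q ^ (r - 1) * q ^ (n - 2 * r) :=
          Nat.mul_lt_mul_of_pos_right hcard (pow_pos hq _)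
      _ = q ^ (n - r - 1) := by rw [← pow_add]; congr 1; omega
  have hsplit : q ^ (n - r) = n * q ^ (n - r - 1) + q ^ (n - r - 1) := by
    rw [← Nat.succ_mul, Nat.succ_eq_add_one, ← hF, ← pow_succ']; congr 1; omega
  omega

open Finset in
/-- The number of subsets of relative size at most `x < 1 / 2` is at most `2 ^ (n H(x))`. -/
theorem card_filter_card_le_two_rpow_binaryEntropy {ι : Type*} [Fintype ι] {x : ℝ} (hx : 0 < x)
    (hx' : x < 1 / 2) :
    (#{S : Finset ι | (#S : ℝ) ≤ x * Fintype.card ι} : ℝ) ≤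
      2 ^ (Fintype.card ι * binaryEntropy x : ℝ) := by
  set n := Fintype.card ι
  have hx1 : 0 < 1 - x := by linarith
  have hkey (S : Finset ι) (hS : (#S : ℝ) ≤ x * n) :
      (2 : ℝ) ^ (-(n * binaryEntropy x) : ℝ) ≤ x ^ #S * (1 - x) ^ (n - #S) := by
    have hle : #S ≤ n := card_le_univ S
    have hlog : Real.logb 2 x ≤ Real.logb 2 (1 - x) :=
      Real.logb_le_logb_of_le (by norm_num) hx (by linarith)
    have heq : x ^ #S * (1 - x) ^ (n - #S) =
        (2 : ℝ) ^ (#S * Real.logb 2 x + ((n : ℝ) - #S) * Real.logb 2 (1 - x)) := by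
      rw [Real.rpow_add two_pos, mul_comm (#S : ℝ), mul_comm ((n : ℝ) - #S),
        Real.rpow_mul two_pos.le, Real.rpow_mul two_pos.le,
        Real.rpow_logb two_pos (by norm_num) hx, Real.rpow_logb two_pos (by norm_num) hx1,
        ← Nat.cast_sub hle, Real.rpow_natCast, Real.rpow_natCast]
    rw [heq]
    refine Real.rpow_le_rpow_of_exponent_le one_le_two ?_
    unfold binaryEntropy
    nlinarith [mul_nonneg (sub_nonneg.2 hS) (sub_nonneg.2 hlog)]
  have hsum : ∑ S : Finset ι, x ^ #S * (1 - x) ^ (n - #S) = 1 := by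
    rw [Fintype.sum_pow_mul_eq_add_pow]; simp
  have hle : (#{S : Finset ι | (#S : ℝ) ≤ x * n} : ℝ) * 2 ^ (-(n * binaryEntropy x) : ℝ) ≤ 1 := by
    rw [← hsum, ← nsmul_eq_mul]
    refine (card_nsmul_le_sum _ _ _ fun S hS => hkey S (by simpa using hS)).trans ?_
    exact sum_le_sum_of_subset_of_nonneg (filter_subset _ _) fun _ _ _ => by positivity
  rwa [Real.rpow_neg two_pos.le, ← div_eq_mul_inv, div_le_one (by positivity)] at hle

theorem binaryEntropy_nonneg {x : ℝ} (hx : 0 ≤ x) (hx' : x ≤ 1) : 0 ≤ binaryEntropy x := by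
  unfold binaryEntropy
  nlinarith [mul_nonneg hx (neg_nonneg.2 (Real.logb_nonpos one_lt_two hx hx')),
    mul_nonneg (sub_nonneg.2 hx')
      (neg_nonneg.2 (Real.logb_nonpos one_lt_two (sub_nonneg.2 hx') (by linarith : 1 - x ≤ 1)))]

/-- The parity-check map of a binary Sub-Alternant code. -/
def parityCheckMap (F : Type*) [Field F] [Algebra (ZMod 2) F] (n r : ℕ) (α : F) (y : Fin n → F) :
    (Fin n → ZMod 2) →ₗ[ZMod 2] (Fin r → F) where
  toFun c s := ∑ i, algebraMap (ZMod 2) F (c i) * (y i * α ^ ((i : ℕ) * s))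
  map_add' c d := by ext s; simp [add_mul, Finset.sum_add_distrib]
  map_smul' k c := by
    ext s
    simp [mul_assoc, Finset.mul_sum, Algebra.smul_def]

theorem coe_ker_parityCheckMap (F : Type*) [Field F] [Algebra (ZMod 2) F] (n r : ℕ) (α : F)
    (y : Fin n → F) :
    (LinearMap.ker (parityCheckMap F n r α y) : Set (Fin n → ZMod 2)) =
      subAlternantCode F n r α y := by
  ext c
  simp [parityCheckMap, subAlternantCode, funext_iff, Fin.forall_iff]

theorem le_finrank_ker_parityCheckMap (F : Type*) [Field F] [Finite F] [Algebra (ZMod 2) F]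
    (n r : ℕ) (α : F) (y : Fin n → F) :
    n ≤ r * Module.finrank (ZMod 2) F +
      Module.finrank (ZMod 2) (LinearMap.ker (parityCheckMap F n r α y)) := by
  have hrank := (parityCheckMap F n r α y).finrank_range_add_finrank_ker
  have hrange := (LinearMap.range (parityCheckMap F n r α y)).finrank_le
  rw [Module.finrank_pi_fintype] at hrange
  simp only [Module.finrank_fintype_fun_eq_card, Fintype.card_fin, Finset.sum_const,
    Finset.card_univ, smul_eq_mul] at hrank hrange
  omega

open Finset in
theorem sum_algebraMap_mul_eq_sum_support {F ι : Type*} [Field F] [Algebra (ZMod 2) F] [Fintype ι]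
    (c : ι → ZMod 2) (f : ι → F) :
    ∑ i, algebraMap (ZMod 2) F (c i) * f i = ∑ i with c i ≠ 0, f i := by
  rw [sum_filter]
  refine sum_congr rfl fun i _ => ?_
  rcases (by decide : ∀ z : ZMod 2, z = 0 ∨ z = 1) (c i) with h | h <;> simp [h]

theorem exists_primitive_and_pow_injective (F : Type*) [Field F] [Fintype F] {n : ℕ}
    (hF : Fintype.card F = n + 1) :
    ∃ α : F, (∀ x : F, x ≠ 0 → ∃ k : ℕ, x = α ^ k) ∧
      Function.Injective fun i : Fin n => α ^ (i : ℕ) := by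
  classical
  obtain ⟨g, hg⟩ := IsCyclic.exists_generator (α := Fˣ)
  have hord : orderOf g = n := by
    rw [orderOf_eq_card_of_forall_mem_zpowers hg, Nat.card_eq_fintype_card, Fintype.card_units, hF,
      Nat.add_sub_cancel]
  refine ⟨g, fun x hx => ?_, fun i j hij => ?_⟩
  · obtain ⟨k, -, hk⟩ := (isOfFinOrder_of_finite g).mem_zpowers_iff_mem_range_orderOf.1
      (hg (Units.mk0 x hx)) |> Finset.mem_image.1
    exact ⟨k, by simpa using (congrArg Units.val hk).symm⟩
  · have h : g ^ (i : ℕ) = g ^ (j : ℕ) := by ext; simpa using hij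
    exact Fin.ext (pow_injOn_Iio_orderOf (by simp [hord]) (by simp [hord]) h)

open Filter in
theorem eventually_mul_le_mul_two_pow_sub_one {ε : ℝ} (hε : 0 < ε) (k : ℝ) :
    ∀ᶠ m : ℕ in atTop, k * m ≤ ε * (2 ^ m - 1) := by
  have h := tendsto_pow_const_div_const_pow_of_one_lt 1 (one_lt_two (α := ℝ))
  have h1 : ∀ᶠ m : ℕ in atTop, (m : ℝ) ^ 1 / 2 ^ m < ε / (|k| + ε) :=
    h.eventually_lt_const (by positivity)
  filter_upwards [h1, eventually_ge_atTop 1] with m hm hm1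
  have hm1' : (1 : ℝ) ≤ m := by exact_mod_cast hm1
  rw [pow_one, div_lt_div_iff₀ (by positivity) (by positivity)] at hm
  nlinarith [mul_le_mul_of_nonneg_right (le_abs_self k) (by linarith : (0 : ℝ) ≤ m)]

/-- For every `0 < δ₀ < 1/2` and `ε > 0` there exist arbitrarily long binary
Sub-Alternant codes containing the all-ones word, of relative minimum distance at
least `δ₀` and rate at least `1 - H(δ₀) - ε`, i.e. meeting the Gilbert–Varshamov
bound. -/
theorem subAlternant_meets_GV
    (δ₀ ε : ℝ) (hδ₀ : 0 < δ₀) (hδ₀' : δ₀ < 1 / 2) (hε : 0 < ε) :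
    ∃ M : ℕ, ∀ m : ℕ, M ≤ m → ∀ n : ℕ, n = 2 ^ m - 1 →
      ∃ (δ r : ℕ) (α : GaloisField 2 m) (y : Fin n → GaloisField 2 m)
        (C : Submodule (ZMod 2) (Fin n → ZMod 2)),
        (∀ x : GaloisField 2 m, x ≠ 0 → ∃ k : ℕ, x = α ^ k) ∧
        2 ≤ δ ∧ δ ≤ n - 1 ∧ 1 ≤ r ∧ r < δ ∧
        (∀ i, y i ≠ 0) ∧
        (∀ s ≤ δ - 2, ∑ i, y i * α ^ ((i : ℕ) * s) = 0) ∧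
        (C : Set (Fin n → ZMod 2)) = subAlternantCode (GaloisField 2 m) n r α y ∧
        (fun _ : Fin n => (1 : ZMod 2)) ∈ C ∧
        (∀ c ∈ C, c ≠ 0 → δ₀ * n ≤ (hammingNorm c : ℝ)) ∧
        (n : ℝ) * (1 - binaryEntropy δ₀ - ε) ≤ (Module.finrank (ZMod 2) C : ℝ) := by
  classical
  set H := binaryEntropy δ₀
  have hH : 0 ≤ H := binaryEntropy_nonneg hδ₀.le (by linarith)
  obtain ⟨M, hM⟩ := Filter.eventually_atTop.1
    ((eventually_mul_le_mul_two_pow_sub_one hε 3).and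
      ((eventually_mul_le_mul_two_pow_sub_one one_pos 12).and
        (Filter.eventually_ge_atTop (⌈4 * H⌉₊ + 1))))
  refine ⟨M, fun m hm n hn => ?_⟩
  obtain ⟨hεm, h12, hHm⟩ := hM m hm
  have hm1 : 1 ≤ m := by omega
  have hm0 : (1 : ℝ) ≤ m := by exact_mod_cast hm1
  have hHm' : 4 * H ≤ m := (Nat.le_ceil _).trans (by exact_mod_cast (by omega : ⌈4 * H⌉₊ ≤ m))
  have hn1 : n + 1 = 2 ^ m := by have := Nat.one_le_two_pow (n := m); omega
  have hnR : (n : ℝ) = 2 ^ m - 1 := by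
    rw [eq_sub_iff_add_eq]; exact_mod_cast hn1
  rw [← hnR] at hεm h12
  have : Fintype (GaloisField 2 m) := Fintype.ofFinite _
  have hF : Fintype.card (GaloisField 2 m) = n + 1 := by
    rw [hn1, ← Nat.card_eq_fintype_card, GaloisField.card 2 m (by omega)]
  obtain ⟨α, hα, hinj⟩ := exists_primitive_and_pow_injective (GaloisField 2 m) hF
  set r := ⌈n * H / m⌉₊ + 2 with hr
  have hr_lower : n * H < m * ((r : ℝ) - 1) := by
    have := Nat.le_ceil (n * H / m)
    rw [div_le_iff₀ (by linarith)] at this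
    rw [hr]; push_cast; nlinarith
  have hr_upper : m * (r : ℝ) ≤ n * H + 3 * m := by
    have := (Nat.ceil_lt_add_one (by positivity : 0 ≤ n * H / m)).le
    rw [← sub_le_iff_le_add, le_div_iff₀ (by linarith)] at this
    rw [hr]; push_cast; nlinarith
  have hrn : 2 * r ≤ n := by
    have h1 : m * (r : ℝ) ≤ m * (n / 2) := by nlinarith
    have h2 := le_of_mul_le_mul_left h1 (by linarith)
    have h3 : (2 * r : ℝ) ≤ n := by linarith
    exact_mod_cast h3
  have hn12 : 12 ≤ n := by
    have : (12 : ℝ) ≤ n := by linarith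
    exact_mod_cast this
  let 𝒜 : Finset (Finset (Fin n)) := {S | S.Nonempty ∧ (S.card : ℝ) ≤ δ₀ * n}
  obtain ⟨y, hy0, hy, hy𝒜⟩ := exists_multiplier (by simpa using hF) hinj (r := r) (by omega)
    (by simpa using hrn) 𝒜 (fun S hS => by
      simp only [𝒜, Finset.mem_filter, Finset.mem_univ, true_and] at hS
      refine ⟨hS.1, ?_⟩
      have h1 : (2 * r : ℝ) ≤ n := by exact_mod_cast hrn
      have h2 : (S.card + r : ℝ) ≤ n := by nlinarith
      simpa using (by exact_mod_cast h2 : S.card + r ≤ n)) (by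
      have h1 : (𝒜.card : ℝ) ≤ 2 ^ (n * H : ℝ) := by
        have := card_filter_card_le_two_rpow_binaryEntropy (ι := Fin n) hδ₀ hδ₀'
        rw [Fintype.card_fin] at this
        refine le_trans ?_ this
        exact_mod_cast Finset.card_le_card fun S hS => by
          simp only [𝒜, Finset.mem_filter, Finset.mem_univ, true_and] at hS ⊢
          exact hS.2
      have h2 : (2 : ℝ) ^ (n * H : ℝ) < 2 ^ (m * (r - 1)) := by
        rw [← Real.rpow_natCast]
        refine Real.rpow_lt_rpow_of_exponent_lt one_lt_two ?_
        rwa [Nat.cast_mul, Nat.cast_sub (by omega), Nat.cast_one]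
      rw [hF, hn1, ← pow_mul]
      exact_mod_cast h1.trans_lt h2)
  simp only [← pow_mul] at hy hy𝒜
  refine ⟨r + 1, r, α, y, LinearMap.ker (parityCheckMap _ n r α y), hα, by omega, by omega,
    by omega, by omega, hy0, fun s hs => hy s (by omega), coe_ker_parityCheckMap _ n r α y,
    ?_, fun c hc hc0 => ?_, ?_⟩
  · rw [← SetLike.mem_coe, coe_ker_parityCheckMap]
    intro s hs
    simpa using hy s hs
  · rw [← SetLike.mem_coe, coe_ker_parityCheckMap] at hc
    by_contra! hlt
    refine hy𝒜 ({i | c i ≠ 0} : Finset (Fin n)) ?_ fun s hs => ?_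
    · simp only [𝒜, Finset.mem_filter, Finset.mem_univ, true_and]
      obtain ⟨i, hi⟩ := Function.ne_iff.1 hc0
      exact ⟨⟨i, by simpa using hi⟩, hlt.le⟩
    · rw [← sum_algebraMap_mul_eq_sum_support]
      exact hc s hs
  · have hdim := le_finrank_ker_parityCheckMap (GaloisField 2 m) n r α y
    rw [GaloisField.finrank 2 (by omega)] at hdim
    have hdim' : (n : ℝ) ≤ r * m +
        Module.finrank (ZMod 2) (LinearMap.ker (parityCheckMap (GaloisField 2 m) n r α y)) := by
      exact_mod_cast hdim
    nlinarith
end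

section
/- For every real δ_z with 0 < δ_z < 1/2 and every ε > 0, there exists M such that for all m ≥ M, setting n = 2^m − 1, there exist binary linear codes C_1, C_2 ⊆ 𝔽_2^n with the following properties: C_1 = {x ∈ 𝔽_2^n : Σ_i x_i = 0} is the even-weight code of dimension n − 1 and minimum distance 2; C_2^⊥ ⊆ C_1 (equivalently C_1^⊥ ⊆ C_2, i.e., the all-ones vector belongs to C_2); every nonzero codeword of C_2 has Hamming weight at least δ_z·n; and dim C_1 + dim C_2 − n ≥ n·(1 − H(δ_z) − ε), where H is the binary entropy function. (Via the CSS construction, such a pair yields an asymmetric quantum code family with d_x = 2, relative Z-distance at least δ_z, and rate attaining the classical Gilbert–Varshamov bound 1 − H(δ_z) − ε.) -/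
/-- The Euclidean dual of a set of codewords `C ⊆ K^ι`. -/
def dualCode (K : Type*) [Field K] {ι : Type*} [Fintype ι] (C : Set (ι → K)) :
    Set (ι → K) :=
  {x | ∀ y ∈ C, ∑ j, x j * y j = 0}

theorem zmod_two_eq_zero_or_one (a : ZMod 2) : a = 0 ∨ a = 1 := by
  revert a
  decide

open Finset in
theorem sum_prod_ite_eq_one (n : ℕ) (p : ℝ) :
    ∑ x : Fin n → ZMod 2, ∏ i, (if x i ≠ 0 then p else 1 - p) = 1 := by
  rw [← Fintype.prod_sum (fun (_ : Fin n) (a : ZMod 2) => if a ≠ 0 then p else 1 - p)]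
  refine prod_eq_one fun _ _ => ?_
  have h : (univ : Finset (ZMod 2)) = {0, 1} := rfl
  rw [h, sum_pair (by decide)]
  simp

open Finset in
theorem prod_ite_ne_zero_eq (n : ℕ) (p : ℝ) (x : Fin n → ZMod 2) :
    ∏ i, (if x i ≠ 0 then p else 1 - p) =
      p ^ hammingNorm x * (1 - p) ^ (n - hammingNorm x) := by
  rw [prod_ite, prod_const, prod_const]
  have h := card_filter_add_card_filter_not (s := (univ : Finset (Fin n))) (fun i => x i ≠ 0)
  rw [card_univ, Fintype.card_fin] at h
  have h' : #{i | ¬ x i ≠ 0} = n - hammingNorm x := by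
    unfold hammingNorm
    omega
  rw [h']
  rfl

theorem two_rpow_neg_mul_binaryEntropy_le {n w : ℕ} {p : ℝ} (hp : 0 < p) (hp' : p < 1 / 2)
    (hwn : w ≤ n) (hw : (w : ℝ) ≤ p * n) :
    (2 : ℝ) ^ (-(n * binaryEntropy p)) ≤ p ^ w * (1 - p) ^ (n - w) := by
  have hq : 0 < 1 - p := by linarith
  have hpos : 0 < p ^ w * (1 - p) ^ (n - w) := by positivity
  rw [← Real.le_logb_iff_rpow_le one_lt_two hpos,
    Real.logb_mul (by positivity) (by positivity), Real.logb_pow, Real.logb_pow,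
    Nat.cast_sub hwn]
  have hlog : Real.logb 2 p ≤ Real.logb 2 (1 - p) :=
    Real.logb_le_logb_of_le one_lt_two hp (by linarith)
  unfold binaryEntropy
  nlinarith [mul_nonneg (sub_nonneg.2 hw) (sub_nonneg.2 hlog)]

open Finset in
/-- The entropy bound for the volume of a Hamming ball. -/
theorem card_hammingNorm_lt_le (n : ℕ) {p : ℝ} (hp : 0 < p) (hp' : p < 1 / 2) :
    (#{x : Fin n → ZMod 2 | (hammingNorm x : ℝ) < p * n} : ℝ) ≤
      (2 : ℝ) ^ (n * binaryEntropy p) := by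
  have hq : 0 < 1 - p := by linarith
  have hle : ∀ x : Fin n → ZMod 2, hammingNorm x ≤ n := fun x => by
    simpa using hammingNorm_le_card_fintype (x := x)
  have h1 := sum_prod_ite_eq_one n p
  simp only [prod_ite_ne_zero_eq] at h1
  have h2 : (#{x : Fin n → ZMod 2 | (hammingNorm x : ℝ) < p * n} : ℝ) *
      (2 : ℝ) ^ (-(n * binaryEntropy p)) ≤ 1 := by
    rw [← h1, ← nsmul_eq_mul]
    refine (card_nsmul_le_sum _ _ _ fun x hx => ?_).trans
      (sum_le_sum_of_subset_of_nonneg (filter_subset _ _) fun x _ _ => by positivity)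
    exact two_rpow_neg_mul_binaryEntropy_le hp hp' (hle x) (mem_filter.1 hx).2.le
  rwa [Real.rpow_neg zero_le_two, ← div_eq_mul_inv, div_le_one (by positivity)] at h2

/-- The Gilbert–Varshamov bound for binary linear codes containing a prescribed code `C₀`. -/
theorem exists_code_ge_card_mul_card_ball (n : ℕ) {d : ℝ} (hd : 0 < d)
    (C₀ : Submodule (ZMod 2) (Fin n → ZMod 2))
    (h₀ : ∀ c ∈ C₀, c ≠ 0 → d ≤ (hammingNorm c : ℝ)) :
    ∃ C : Submodule (ZMod 2) (Fin n → ZMod 2), C₀ ≤ C ∧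
      (∀ c ∈ C, c ≠ 0 → d ≤ (hammingNorm c : ℝ)) ∧
      2 ^ n ≤ 2 ^ Module.finrank (ZMod 2) C *
        Finset.card {x : Fin n → ZMod 2 | (hammingNorm x : ℝ) < d} := by
  classical
  obtain ⟨C, ⟨hC₀, hC⟩, hmax⟩ := (Set.toFinite {C : Submodule (ZMod 2) (Fin n → ZMod 2) |
    C₀ ≤ C ∧ ∀ c ∈ C, c ≠ 0 → d ≤ (hammingNorm c : ℝ)}).exists_maximal ⟨C₀, le_rfl, h₀⟩
  refine ⟨C, hC₀, hC, ?_⟩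
  have hcover : ∀ v, ∃ c ∈ C, (hammingNorm (v - c) : ℝ) < d := by
    intro v
    by_contra! hv
    have hmem : v ∈ C := by
      refine hmax (y := C ⊔ Submodule.span (ZMod 2) {v}) ⟨hC₀.trans le_sup_left, ?_⟩ le_sup_left
        (Submodule.mem_sup_right (Submodule.mem_span_singleton_self v))
      intro c hc hc0
      obtain ⟨y, hy, z, hz, rfl⟩ := Submodule.mem_sup.1 hc
      obtain ⟨a, rfl⟩ := Submodule.mem_span_singleton.1 hz
      obtain rfl | rfl : a = 0 ∨ a = 1 := zmod_two_eq_zero_or_one a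
      · simp only [zero_smul, add_zero] at hc0 ⊢
        exact hC y hy hc0
      · have := hv (-y) (C.neg_mem hy)
        rwa [sub_neg_eq_add, add_comm, ← one_smul (ZMod 2) v] at this
    exact hd.not_ge (by simpa using hv v hmem)
  have hcard : Fintype.card (Fin n → ZMod 2) = 2 ^ n := by simp [ZMod.card]
  have hcardC : Fintype.card C = 2 ^ Module.finrank (ZMod 2) C := by
    rw [Module.card_eq_pow_finrank (K := ZMod 2), ZMod.card]
  rw [← hcard, ← hcardC, ← Finset.card_univ, ← Finset.card_univ, ← Finset.card_product]
  refine Finset.card_le_card_of_surjOn (fun q => (q.1 : Fin n → ZMod 2) + q.2) fun v _ => ?_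
  obtain ⟨c, hc, hv⟩ := hcover v
  exact ⟨(⟨c, hc⟩, v - c), by simpa using hv, by simp⟩

/-- The binary code of all words of even weight. -/
def evenWeightCode (n : ℕ) : Submodule (ZMod 2) (Fin n → ZMod 2) :=
  LinearMap.ker (∑ i, LinearMap.proj i : (Fin n → ZMod 2) →ₗ[ZMod 2] ZMod 2)

theorem mem_evenWeightCode {n : ℕ} {x : Fin n → ZMod 2} :
    x ∈ evenWeightCode n ↔ ∑ i, x i = 0 := by
  simp [evenWeightCode]

theorem finrank_evenWeightCode {n : ℕ} (hn : 0 < n) :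
    Module.finrank (ZMod 2) (evenWeightCode n) = n - 1 := by
  set f : (Fin n → ZMod 2) →ₗ[ZMod 2] ZMod 2 := ∑ i, LinearMap.proj i with hf
  have hsurj : Function.Surjective f := fun a => ⟨Pi.single ⟨0, hn⟩ a, by simp [hf]⟩
  have h := f.finrank_range_add_finrank_ker
  rw [LinearMap.range_eq_top.2 hsurj, finrank_top, Module.finrank_self,
    Module.finrank_fin_fun] at h
  change Module.finrank (ZMod 2) (LinearMap.ker f) = n - 1
  omega

theorem sum_eq_hammingNorm {n : ℕ} (x : Fin n → ZMod 2) :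
    ∑ i, x i = (hammingNorm x : ZMod 2) := by
  unfold hammingNorm
  rw [← Finset.sum_boole]
  refine Finset.sum_congr rfl fun i _ => ?_
  obtain h | h := zmod_two_eq_zero_or_one (x i) <;> simp [h]

theorem two_le_hammingNorm_of_mem_evenWeightCode {n : ℕ} {x : Fin n → ZMod 2}
    (hx : x ∈ evenWeightCode n) (hx0 : x ≠ 0) : 2 ≤ hammingNorm x := by
  rw [mem_evenWeightCode, sum_eq_hammingNorm, ZMod.natCast_eq_zero_iff] at hx
  exact Nat.le_of_dvd (hammingNorm_pos_iff.2 hx0) hx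

theorem exists_mem_evenWeightCode_hammingNorm_eq_two {n : ℕ} (hn : 2 ≤ n) :
    ∃ x ∈ evenWeightCode n, x ≠ 0 ∧ hammingNorm x = 2 := by
  let s : Finset (Fin n) := {⟨0, by omega⟩, ⟨1, by omega⟩}
  have hs : s.card = 2 := Finset.card_pair (by simp)
  let x : Fin n → ZMod 2 := fun i => if i ∈ s then 1 else 0
  have hx : hammingNorm x = 2 := by simp [hammingNorm, x, hs]
  refine ⟨x, ?_, ?_, hx⟩
  · rw [mem_evenWeightCode, sum_eq_hammingNorm, hx]
    rfl
  · rw [← hammingNorm_ne_zero_iff, hx]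
    decide

/-- For every `0 < δ_z < 1/2` and `ε > 0`, for all sufficiently large `m` and
`n = 2^m - 1`, there are binary linear codes `C₁, C₂ ⊆ 𝔽_2^n` where `C₁` is the
even-weight code (dimension `n-1`, minimum distance `2`), `C₂^⊥ ⊆ C₁`, every
nonzero codeword of `C₂` has weight at least `δ_z·n`, and
`dim C₁ + dim C₂ - n ≥ n(1 - H(δ_z) - ε)`.  Via the CSS construction this gives
asymmetric quantum codes with `d_x = 2` whose `Z`-part meets the classical
Gilbert–Varshamov bound. -/
theorem aqc_dx_two_meets_GV
    (δz ε : ℝ) (hδz : 0 < δz) (hδz' : δz < 1 / 2) (hε : 0 < ε) :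
    ∃ M : ℕ, ∀ m : ℕ, M ≤ m → ∀ n : ℕ, n = 2 ^ m - 1 →
      ∃ C₁ C₂ : Submodule (ZMod 2) (Fin n → ZMod 2),
        (C₁ : Set (Fin n → ZMod 2)) = {x | ∑ i, x i = 0} ∧
        Module.finrank (ZMod 2) C₁ = n - 1 ∧
        (∀ x ∈ C₁, x ≠ 0 → 2 ≤ hammingNorm x) ∧
        (∃ x ∈ C₁, x ≠ 0 ∧ hammingNorm x = 2) ∧
        dualCode (ZMod 2) (C₂ : Set (Fin n → ZMod 2)) ⊆ (C₁ : Set (Fin n → ZMod 2)) ∧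
        (∀ c ∈ C₂, c ≠ 0 → δz * n ≤ (hammingNorm c : ℝ)) ∧
        (n : ℝ) * (1 - binaryEntropy δz - ε) ≤
          (Module.finrank (ZMod 2) C₁ : ℝ) + (Module.finrank (ZMod 2) C₂ : ℝ) - n := by
  obtain ⟨M, hM⟩ := exists_nat_ge (1 / ε)
  refine ⟨max M 2, fun m hm n hn => ?_⟩
  have hmn : m ≤ n := by
    have := Nat.lt_two_pow_self (n := m)
    omega
  have hn2 : 2 ≤ n := (le_max_right M 2).trans (hm.trans hmn)
  have hn0 : (0 : ℝ) < n := by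
    have : 0 < n := by omega
    exact_mod_cast this
  have hnε : 1 ≤ n * ε := by
    have : (M : ℝ) ≤ n := by exact_mod_cast (le_max_left M 2).trans (hm.trans hmn)
    exact (div_le_iff₀ hε).1 (hM.trans this)
  obtain ⟨C, hones, hC, hcard⟩ := exists_code_ge_card_mul_card_ball n (mul_pos hδz hn0)
    (Submodule.span (ZMod 2) {1}) (by
      intro c hc hc0
      obtain ⟨a, rfl⟩ := Submodule.mem_span_singleton.1 hc
      obtain rfl | rfl : a = 0 ∨ a = 1 := zmod_two_eq_zero_or_one a
      · simp at hc0
      · have : hammingNorm ((1 : ZMod 2) • (1 : Fin n → ZMod 2)) = n := by simp [hammingNorm]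
        rw [this]
        nlinarith)
  refine ⟨evenWeightCode n, C, Set.ext fun x => mem_evenWeightCode,
    finrank_evenWeightCode (by omega),
    fun x hx hx0 => two_le_hammingNorm_of_mem_evenWeightCode hx hx0,
    exists_mem_evenWeightCode_hammingNorm_eq_two hn2, fun x hx => ?_, hC, ?_⟩
  · rw [SetLike.mem_coe, mem_evenWeightCode]
    simpa using hx 1 (hones (Submodule.mem_span_singleton_self 1))
  · have h1 : (2 : ℝ) ^ (n : ℝ) ≤
        2 ^ ((Module.finrank (ZMod 2) C : ℝ) + n * binaryEntropy δz) := by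
      rw [Real.rpow_add two_pos, Real.rpow_natCast, Real.rpow_natCast]
      calc (2 : ℝ) ^ n ≤ 2 ^ Module.finrank (ZMod 2) C *
            (Finset.card {x : Fin n → ZMod 2 | (hammingNorm x : ℝ) < δz * n} : ℝ) := by
            exact_mod_cast hcard
        _ ≤ _ := by
            gcongr
            exact card_hammingNorm_lt_le n hδz hδz'
    rw [Real.rpow_le_rpow_left_iff one_lt_two] at h1
    rw [finrank_evenWeightCode (by omega), Nat.cast_sub (by omega), Nat.cast_one]
    linarith
end
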